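/- arXiv:2005.14232 — 2 statements merged into one kernel-verified Lean document; each statement's English description precedes it below -/
import Mathlib

section
/- Let Y be a set with a constant θ ≥ 0 and functions d_y : (Y ∖ {y}) × (Y ∖ {y}) → [0,∞) satisfying the projection complex axioms, and let L > 14θ. Suppose (w_j)_{j ∈ ℤ} is a bi-infinite sequence of points of Y such that d_{w_{j_1}}(w_{j_0}, w_{j_2}) ≥ L/2 − 2θ for all integers j_0 < j_1 < j_2, and x ∈ Y is a point distinct from every w_j. Then there exists an integer J such that d_{w_j}(w_{j−1}, x) > θ for all j ≤ J and d_{w_j}(w_{j−1}, x) ≤ θ for all j > J. -/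
open Filter Set


/-- **The claim in Proposition 3.2 (Clay–Mangahas).**  Let `Y` be a set with projection
distance functions `d y : (Y ∖ {y})² → [0,∞)` (here recorded as total functions, the
axioms guarded by the definedness conditions) satisfying the projection complex axioms
with constant `θ ≥ 0`, and let `L > 14θ`.  If `(w_j)_{j ∈ ℤ}` is a bi-infinite sequence
of (necessarily distinct) points with `d_{w_{j₁}}(w_{j₀}, w_{j₂}) ≥ L/2 - 2θ` for all
`j₀ < j₁ < j₂`, and `x` is a point distinct from every `w_j`, then there is `J ∈ ℤ`
with `d_{w_j}(w_{j-1}, x) > θ` for all `j ≤ J` and `d_{w_j}(w_{j-1}, x) ≤ θ` for all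
`j > J`. -/
theorem pivot_sequence_threshold {Y : Type*} (θ : ℝ) (d : Y → Y → Y → ℝ)
    (theta_nonneg : 0 ≤ θ)
    (d_nonneg : ∀ v x z, 0 ≤ d v x z)
    (d_symm : ∀ v x z, x ≠ v → z ≠ v → d v x z = d v z x)
    (d_triangle : ∀ v x z w, x ≠ v → z ≠ v → w ≠ v → d v x w ≤ d v x z + d v z w)
    (d_triples : ∀ x y z, x ≠ y → y ≠ z → x ≠ z → min (d y x z) (d z x y) ≤ θ)
    (d_finite : ∀ x z, {y : Y | y ≠ x ∧ y ≠ z ∧ θ < d y x z}.Finite)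
    (L : ℝ) (hL : 14 * θ < L)
    (w : ℤ → Y) (hw : Function.Injective w)
    (hsep : ∀ j₀ j₁ j₂ : ℤ, j₀ < j₁ → j₁ < j₂ → L / 2 - 2 * θ ≤ d (w j₁) (w j₀) (w j₂))
    (x : Y) (hx : ∀ j : ℤ, x ≠ w j) :
    ∃ J : ℤ, ∀ j : ℤ, (j ≤ J → θ < d (w j) (w (j - 1)) x) ∧
      (J < j → d (w j) (w (j - 1)) x ≤ θ) := by
  have hne : ∀ {i j : ℤ}, i ≠ j → w i ≠ w j := fun h e => h (hw e)
  -- Closeness of `x` to one side of a pivot forces a large distance to the other side.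
  have right_far : ∀ i j k : ℤ, i < j → j < k → d (w j) (w k) x ≤ θ → θ < d (w j) (w i) x := by
    intro i j k hij hjk h
    have hs := hsep i j k hij hjk
    have ht := d_triangle (w j) (w i) x (w k) (hne hij.ne) (hx j) (hne hjk.ne')
    rw [d_symm (w j) x (w k) (hx j) (hne hjk.ne')] at ht
    linarith
  have left_far : ∀ i j k : ℤ, i < j → j < k → d (w j) (w i) x ≤ θ → θ < d (w j) (w k) x := by
    intro i j k hij hjk h
    by_contra! hk
    exact absurd h (not_le.mpr (right_far i j k hij hjk hk))
  have far_of_succ : ∀ i j : ℤ, i < j → θ < d (w (j + 1)) (w j) x → θ < d (w j) (w i) x := by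
    intro i j hij h
    refine right_far i j (j + 1) hij (by lia) ?_
    have ht := d_triples x (w (j + 1)) (w j) (hx _) (hne (by lia)) (hx _)
    rw [d_symm (w (j + 1)) x (w j) (hx _) (hne (by lia)),
      d_symm (w j) x (w (j + 1)) (hx _) (hne (by lia))] at ht
    exact (min_le_iff.mp ht).resolve_left (not_le.mpr h)
  have not_all_far : ∀ s : Set ℤ, s.Infinite → 0 ∉ s → ∃ j ∈ s, d (w j) (w 0) x ≤ θ := by
    intro s hs h0
    by_contra! h
    refine (hs.image hw.injOn) ((d_finite (w 0) x).subset ?_)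
    rintro _ ⟨j, hj, rfl⟩
    exact ⟨hne (fun e => h0 (e ▸ hj)), (hx j).symm, h j hj⟩
  have down : ∀ j : ℤ, θ < d (w j) (w (j - 1)) x →
      θ < d (w (j - 1)) (w (j - 1 - 1)) x := by
    intro j h
    refine far_of_succ _ _ (by lia) ?_
    rwa [sub_add_cancel]
  have down_le : ∀ i j : ℤ, i ≤ j → θ < d (w j) (w (j - 1)) x → θ < d (w i) (w (i - 1)) x := by
    intro i j hij h
    induction i, hij using Int.leInductionDown with
    | base => exact h
    | pred n _ ih => exact down n ih
  have some_near : ∃ b : ℤ, d (w b) (w (b - 1)) x ≤ θ := by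
    by_contra! h
    obtain ⟨j, hj, hle⟩ := not_all_far (Ioi 0) (Ioi_infinite 0) (by simp)
    refine absurd hle (not_le.mpr (far_of_succ 0 j hj ?_))
    simpa using h (j + 1)
  have some_far : ∃ a : ℤ, θ < d (w a) (w (a - 1)) x := by
    by_contra! h
    obtain ⟨j, hj, hle⟩ := not_all_far (Iio 0) (Iio_infinite 0) (by simp)
    exact absurd hle (not_le.mpr (left_far (j - 1) j 0 (by lia) hj (h j)))
  obtain ⟨b, hb⟩ := some_near
  obtain ⟨J, hJ, hmax⟩ := Int.exists_greatest_of_bdd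
    (P := fun j : ℤ => θ < d (w j) (w (j - 1)) x)
    ⟨b, fun z hz => by
      by_contra! hlt
      exact absurd hb (not_le.mpr (down_le b z hlt.le hz))⟩ some_far
  refine ⟨J, fun j => ⟨fun h => down_le j J h hJ, fun h => ?_⟩⟩
  by_contra! hj
  exact absurd (hmax j hj) (not_le.mpr h)
end

section
/- Let P be a projection complex and let f be a hyperbolic isometry of P (for the path metric on P). Then for any vertex x_0 of P there is a constant B_f such that d_v(x_0, f^n x_0) ≤ B_f for all n ∈ ℤ and all vertices v for which this quantity is defined (i.e. all v ∉ {x_0, f^n x_0}). -/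
open Filter Set

/-- A projection complex in the sense of Bestvina–Bromberg–Fujiwara, as used by
Clay–Mangahas: a vertex set `Y` with projection distance functions `d v x z = d_v(x,z)`
(defined for `x, z ≠ v`; here recorded as total functions, with the axioms guarded by
the definedness conditions), together with a connected graph on `Y`, with its path
metric `graph.dist`, satisfying the bounded edge, path and geodesic image properties
with constants `Ce`, `Cp`, `Cg`. -/
structure ProjComplex (Y : Type*) where
  theta : ℝ
  theta_nonneg : 0 ≤ theta
  d : Y → Y → Y → ℝ
  d_nonneg : ∀ v x z, 0 ≤ d v x z
  d_symm : ∀ v x z, x ≠ v → z ≠ v → d v x z = d v z x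
  d_triangle : ∀ v x z w, x ≠ v → z ≠ v → w ≠ v → d v x w ≤ d v x z + d v z w
  d_triples : ∀ x y z, x ≠ y → y ≠ z → x ≠ z → min (d y x z) (d z x y) ≤ theta
  d_finite : ∀ x z, {y : Y | y ≠ x ∧ y ≠ z ∧ theta < d y x z}.Finite
  graph : SimpleGraph Y
  connected : graph.Connected
  Ce : ℝ
  Cp : ℝ
  Cg : ℝ
  bounded_edge : ∀ x y z, x ≠ y → z ≠ y → graph.Adj x z → d y x z ≤ Ce
  bounded_path : ∀ (x z y : Y) (n : ℕ) (c : ℕ → Y), x ≠ y → z ≠ y →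
    (∀ i < n, graph.Adj (c i) (c (i + 1))) → c 0 = x → c n = z →
    (∀ i ≤ n, 2 < graph.dist (c i) y) → d y x z ≤ Cp
  bounded_geodesic : ∀ (x z y : Y) (n : ℕ) (c : ℕ → Y), x ≠ y → z ≠ y →
    (∀ i < n, graph.Adj (c i) (c (i + 1))) → c 0 = x → c n = z →
    graph.dist x z = n → (∀ i ≤ n, c i ≠ y) → d y x z ≤ Cg

/-- A group `G` acts on the projection complex `pc` if it acts on the vertex set by
graph automorphisms preserving the projection distances. -/
def PCAction {Y : Type*} (pc : ProjComplex Y) (G : Type*) [Group G] [MulAction G Y] : Prop :=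
  (∀ (g : G) (x z : Y), pc.graph.Adj x z → pc.graph.Adj (g • x) (g • z)) ∧
  (∀ (g : G) (v x z : Y), pc.d (g • v) (g • x) (g • z) = pc.d v x z)

/-- The permutations of the vertex set that preserve adjacency and projection distances. -/
def ProjComplex.automorphisms {Y : Type*} (pc : ProjComplex Y) : Subgroup (Equiv.Perm Y) where
  carrier := {g | (∀ x z, pc.graph.Adj (g x) (g z) ↔ pc.graph.Adj x z) ∧
    ∀ v x z, pc.d (g v) (g x) (g z) = pc.d v x z}
  mul_mem' {a b} ha hb := by
    refine ⟨fun x z => ?_, fun v x z => ?_⟩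
    · simp [ha.1, hb.1]
    · simp [ha.2, hb.2]
  one_mem' := by simp
  inv_mem' {a} ha := by
    refine ⟨fun x z => ?_, fun v x z => ?_⟩
    · simpa using (ha.1 (a⁻¹ x) (a⁻¹ z)).symm
    · simpa using (ha.2 (a⁻¹ v) (a⁻¹ x) (a⁻¹ z)).symm

namespace ProjComplex

variable {Y : Type*} (pc : ProjComplex Y)

theorem dist_apply_le {g : Equiv.Perm Y} (hg : g ∈ pc.automorphisms) (x z : Y) :
    pc.graph.dist (g x) (g z) ≤ pc.graph.dist x z := by
  obtain ⟨p, hp⟩ := pc.connected.exists_walk_length_eq_dist x z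
  let φ : pc.graph →g pc.graph := ⟨g, fun {a b} h => (hg.1 a b).2 h⟩
  have h := SimpleGraph.dist_le (p.map φ)
  rw [SimpleGraph.Walk.length_map, hp] at h
  exact h

theorem dist_apply {g : Equiv.Perm Y} (hg : g ∈ pc.automorphisms) (x z : Y) :
    pc.graph.dist (g x) (g z) = pc.graph.dist x z := by
  refine le_antisymm (pc.dist_apply_le hg x z) ?_
  simpa using pc.dist_apply_le (inv_mem hg) (g x) (g z)

theorem d_self_le {v x : Y} (h : x ≠ v) : pc.d v x x ≤ pc.Cg :=
  pc.bounded_geodesic x x v 0 (fun _ => x) h h (by simp) rfl rfl (by simp) (by simp [h])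

theorem d_le_of_path_avoids {c : ℤ → Y} (hc : ∀ i, pc.graph.Adj (c i) (c (i + 1))) {v : Y}
    (i : ℤ) (n : ℕ) (h : ∀ k, i ≤ k → k ≤ i + n → c k ≠ v) :
    pc.d v (c i) (c (i + n)) ≤ pc.Cg + n * |pc.Ce| := by
  induction n with
  | zero => simpa using pc.d_self_le (h i le_rfl (by simp))
  | succ n ih =>
    have h0 := h i le_rfl (by lia)
    have h1 := h (i + n) (by lia) (by lia)
    have h2 := h (i + n + 1) (by lia) (by lia)
    have ih' := ih fun k hk hk' => h k hk (by lia)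
    have ht := pc.d_triangle v _ _ _ h0 h1 h2
    have he := (pc.bounded_edge _ _ _ h1 h2 (hc _)).trans (le_abs_self _)
    push_cast
    rw [← add_assoc]
    linarith

theorem d_le_of_path_far {c : ℤ → Y} (hc : ∀ i, pc.graph.Adj (c i) (c (i + 1))) {v : Y}
    {i j : ℤ} (hij : i ≤ j) (h : ∀ k, i ≤ k → k ≤ j → 2 < pc.graph.dist (c k) v) :
    pc.d v (c i) (c j) ≤ pc.Cp := by
  have hne : ∀ k, i ≤ k → k ≤ j → c k ≠ v := fun k hk hk' he => by
    have := h k hk hk'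
    simp [he] at this
  refine pc.bounded_path _ _ v (j - i).toNat (fun k => c (i + k)) (hne i le_rfl hij)
    (hne j hij le_rfl) (fun k _ => ?_) (by simp) ?_ (fun k hk => h _ (by lia) (by lia))
  · push_cast
    rw [← add_assoc]
    exact hc _
  · congr 1
    lia

/-- A biinfinite path that leaves bounded sets at a uniform rate, and whose projections to its own
vertices are locally bounded, has uniformly bounded projections. -/
theorem d_le_of_proper_path {c : ℤ → Y} (hc : ∀ i, pc.graph.Adj (c i) (c (i + 1)))
    {K : ℕ} (hK : ∀ i j : ℤ, pc.graph.dist (c i) (c j) ≤ 4 → j - i ≤ K)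
    {M : ℝ} (hM : ∀ i k j : ℤ, i ≤ k → k ≤ j → j - i ≤ K + 2 → pc.d (c k) (c i) (c j) ≤ M)
    {a b : ℤ} (hab : a ≤ b) {v : Y} (ha : c a ≠ v) (hb : c b ≠ v) :
    pc.d v (c a) (c b) ≤ 3 * |pc.Cg| + 2 * |pc.Cp| + |M| + (K + 2) * |pc.Ce| := by
  have hCe : 0 ≤ (K + 2) * |pc.Ce| := by positivity
  have hCp := abs_nonneg pc.Cp
  have hCg := abs_nonneg pc.Cg
  have hM0 := abs_nonneg M
  have lCp := le_abs_self pc.Cp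
  have lCg := le_abs_self pc.Cg
  have lM := le_abs_self M
  let S : Finset ℤ := (Finset.Icc a b).filter fun i => pc.graph.dist (c i) v ≤ 2
  have memS : ∀ i, i ∈ S ↔ (a ≤ i ∧ i ≤ b) ∧ pc.graph.dist (c i) v ≤ 2 := by simp [S]
  have far_ne : ∀ i, a ≤ i → i ≤ b → i ∉ S → c i ≠ v := fun i hi hi' hS he =>
    hS ((memS i).2 ⟨⟨hi, hi'⟩, by simp [he]⟩)
  rcases S.eq_empty_or_nonempty with hS | hS
  · have := pc.d_le_of_path_far hc (v := v) hab fun k hk hk' => by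
      by_contra hcon
      have : k ∈ S := (memS k).2 ⟨⟨hk, hk'⟩, by lia⟩
      simp [hS] at this
    linarith
  obtain ⟨⟨hi1, hi2⟩, hi3⟩ := (memS _).1 (S.min'_mem hS)
  obtain ⟨⟨hj1, hj2⟩, hj3⟩ := (memS _).1 (S.max'_mem hS)
  have hmin : ∀ k ∈ S, S.min' hS ≤ k := fun k hk => S.min'_le k hk
  have hmax : ∀ k ∈ S, k ≤ S.max' hS := fun k hk => S.le_max' k hk
  have hij := hmin _ (S.max'_mem hS)
  generalize S.min' hS = i at *
  generalize S.max' hS = j at *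
  have hjK : j - i ≤ K := by
    refine hK i j ?_
    have := pc.connected.dist_triangle (u := c i) (v := v) (w := c j)
    rw [SimpleGraph.dist_comm (u := v)] at this
    lia
  obtain ⟨i', hi', hi'a, hi'n, hi'd⟩ : ∃ i', (i - 1 ≤ i' ∧ i' ≤ i) ∧ a ≤ i' ∧ c i' ≠ v ∧
      pc.d v (c a) (c i') ≤ |pc.Cp| + |pc.Cg| := by
    rcases hi1.eq_or_lt with rfl | h
    · exact ⟨a, by lia, le_rfl, ha, by linarith [pc.d_self_le ha]⟩
    · refine ⟨i - 1, by lia, by lia, far_ne _ (by lia) (by lia) fun hs => ?_, ?_⟩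
      · have := hmin _ hs
        lia
      · have := pc.d_le_of_path_far hc (i := a) (j := i - 1) (v := v) (by lia)
          fun k hk hk' => by
            by_contra hcon
            have := hmin k ((memS k).2 ⟨⟨hk, by lia⟩, by lia⟩)
            lia
        linarith
  obtain ⟨j', hj', hj'b, hj'n, hj'd⟩ : ∃ j', (j ≤ j' ∧ j' ≤ j + 1) ∧ j' ≤ b ∧ c j' ≠ v ∧
      pc.d v (c j') (c b) ≤ |pc.Cp| + |pc.Cg| := by
    rcases hj2.eq_or_lt with rfl | h
    · exact ⟨j, by lia, le_rfl, hb, by linarith [pc.d_self_le hb]⟩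
    · refine ⟨j + 1, by lia, by lia, far_ne _ (by lia) (by lia) fun hs => ?_, ?_⟩
      · have := hmax _ hs
        lia
      · have := pc.d_le_of_path_far hc (i := j + 1) (j := b) (v := v) (by lia)
          fun k hk hk' => by
            by_contra hcon
            have := hmax k ((memS k).2 ⟨⟨by lia, hk'⟩, by lia⟩)
            lia
        linarith
  have hmid : pc.d v (c i') (c j') ≤ |pc.Cg| + |M| + (K + 2) * |pc.Ce| := by
    by_cases hv : ∃ k, i' ≤ k ∧ k ≤ j' ∧ c k = v
    · obtain ⟨k, hk, hk', rfl⟩ := hv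
      have := hM i' k j' hk hk' (by lia)
      linarith
    · push Not at hv
      obtain ⟨n, hn⟩ : ∃ n : ℕ, j' = i' + n := ⟨(j' - i').toNat, by lia⟩
      have h := pc.d_le_of_path_avoids hc i' n fun k hk hk' => hv k hk (by lia)
      rw [← hn] at h
      have hnK : (n : ℝ) ≤ K + 2 := by
        have : n ≤ K + 2 := by lia
        exact_mod_cast this
      have := mul_le_mul_of_nonneg_right hnK (abs_nonneg pc.Ce)
      linarith
  have t1 := pc.d_triangle v _ _ _ ha hi'n hb
  have t2 := pc.d_triangle v _ _ _ hi'n hj'n hb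
  linarith

/-- A uniform bound on the projections of short segments of a periodic path to its vertices. -/
theorem exists_d_le_of_periodic {c : ℤ → Y} {L : ℤ} (hL : 0 < L) {f : Equiv.Perm Y}
    (hf : f ∈ pc.automorphisms) (hcf : ∀ i q : ℤ, c (i + L * q) = (f ^ q) (c i)) (N : ℤ) :
    ∃ M : ℝ, ∀ i k j : ℤ, i ≤ k → k ≤ j → j - i ≤ N → pc.d (c k) (c i) (c j) ≤ M := by
  let F : ℤ × ℤ × ℤ → ℝ := fun t => pc.d (c t.1) (c t.2.1) (c t.2.2)
  obtain ⟨M, hM⟩ := ((Set.finite_Icc (0, -N, 0) (L, L, L + N)).image F).bddAbove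
  refine ⟨M, fun i k j hik hkj hji => ?_⟩
  have hk := Int.emod_add_mul_ediv k L
  have h0 := Int.emod_nonneg k hL.ne'
  have h1 := Int.emod_lt_of_pos k hL
  have hshift : F (k % L, i - L * (k / L), j - L * (k / L)) = pc.d (c k) (c i) (c j) := by
    simp only [F]
    rw [← (zpow_mem hf (k / L)).2 (c (k % L))]
    simp only [← hcf, sub_add_cancel, hk]
  rw [← hshift]
  exact hM (Set.mem_image_of_mem F (by
    simp only [Set.mem_Icc, Prod.mk_le_mk]
    lia))

theorem mul_le_dist_zpow {f : Equiv.Perm Y} (hf : f ∈ pc.automorphisms) {x : Y} {l : ℝ}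
    (hl : Tendsto (fun n : ℕ => (pc.graph.dist x ((f ^ n) x) : ℝ) / n) atTop (nhds l))
    (x₀ : Y) (p q : ℤ) :
    l * |(q - p : ℤ)| ≤ pc.graph.dist ((f ^ p) x₀) ((f ^ q) x₀) + 2 * pc.graph.dist x x₀ := by
  have hsub : Subadditive fun n : ℕ => (pc.graph.dist x ((f ^ n) x) : ℝ) := fun m n => by
    have h := pc.connected.dist_triangle (u := x) (v := (f ^ m) x) (w := (f ^ (m + n)) x)
    rw [pow_add, Equiv.Perm.mul_apply, pc.dist_apply (pow_mem hf m)] at h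
    dsimp only
    rw [pow_add, Equiv.Perm.mul_apply]
    exact_mod_cast h
  have hbdd : BddBelow (Set.range fun n : ℕ => (pc.graph.dist x ((f ^ n) x) : ℝ) / n) :=
    ⟨0, by rintro _ ⟨n, rfl⟩; positivity⟩
  have hlim : hsub.lim = l := tendsto_nhds_unique (hsub.tendsto_lim hbdd) hl
  have hnat : ∀ n : ℕ, l * n ≤ pc.graph.dist x ((f ^ n) x) := fun n => by
    rcases n.eq_zero_or_pos with rfl | hn
    · simp
    · have h := hsub.lim_le_div hbdd hn.ne'
      rw [hlim, le_div_iff₀ (by exact_mod_cast hn)] at h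
      exact h
  wlog hpq : p ≤ q generalizing p q
  · have h := this q p (by lia)
    rwa [SimpleGraph.dist_comm, ← neg_sub, abs_neg] at h
  obtain ⟨n, rfl⟩ : ∃ n : ℕ, q = p + n := ⟨(q - p).toNat, by lia⟩
  have hn := hnat n
  have t1 := pc.connected.dist_triangle (u := x) (v := x₀) (w := (f ^ n) x)
  have t2 := pc.connected.dist_triangle (u := x₀) (v := (f ^ n) x₀) (w := (f ^ n) x)
  rw [pc.dist_apply (pow_mem hf n), SimpleGraph.dist_comm (u := x₀) (v := x)] at t2
  rw [zpow_add, Equiv.Perm.mul_apply, pc.dist_apply (zpow_mem hf p), zpow_natCast]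
  have t3 : (pc.graph.dist x ((f ^ n) x) : ℝ) ≤
      pc.graph.dist x₀ ((f ^ n) x₀) + 2 * pc.graph.dist x x₀ := by
    exact_mod_cast (by lia : pc.graph.dist x ((f ^ n) x) ≤
      pc.graph.dist x₀ ((f ^ n) x₀) + 2 * pc.graph.dist x x₀)
  simp only [add_sub_cancel_left, Nat.abs_cast, Int.cast_natCast]
  linarith

/-- Translating a walk from `x₀` to `f x₀` by the powers of `f` gives a biinfinite path. -/
theorem exists_periodic_path {f : Equiv.Perm Y} (hf : f ∈ pc.automorphisms) {x₀ : Y}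
    (hx₀ : f x₀ ≠ x₀) :
    ∃ (L : ℕ) (c : ℤ → Y), 0 < L ∧ (∀ i, pc.graph.Adj (c i) (c (i + 1))) ∧ c 0 = x₀ ∧
      (∀ i q : ℤ, c (i + L * q) = (f ^ q) (c i)) ∧
      ∀ i : ℤ, 0 ≤ i → i < L → pc.graph.dist x₀ (c i) ≤ L := by
  obtain ⟨p⟩ := pc.connected.preconnected x₀ (f x₀)
  have hL : 0 < p.length := by
    by_contra h
    exact hx₀ (SimpleGraph.Walk.eq_of_length_eq_zero (by lia : p.length = 0)).symm
  have hL' : (0 : ℤ) < p.length := by exact_mod_cast hL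
  let c : ℤ → Y := fun i => (f ^ (i / p.length)) (p.getVert (i % p.length).toNat)
  have hcf : ∀ i q : ℤ, c (i + p.length * q) = (f ^ q) (c i) := fun i q => by
    simp only [c, Int.add_mul_ediv_left _ _ hL'.ne', Int.add_mul_emod_self_left]
    rw [add_comm, zpow_add, Equiv.Perm.mul_apply]
  have hc : ∀ i : ℕ, i ≤ p.length → c i = p.getVert i := fun i hi => by
    rcases hi.eq_or_lt with rfl | hi
    · simp [c, hL.ne']
    · have h1 : (i : ℤ) / p.length = 0 := Int.ediv_eq_zero_of_lt (by lia) (by lia)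
      have h2 : (i : ℤ) % p.length = i := Int.emod_eq_of_lt (by lia) (by lia)
      simp [c, h1, h2]
  refine ⟨p.length, c, hL, fun i => ?_, ?_, hcf, fun i h0 h1 => ?_⟩
  · have hi := Int.emod_add_mul_ediv i p.length
    obtain ⟨n, hn⟩ : ∃ n : ℕ, i % p.length = n := ⟨_, (Int.toNat_of_nonneg
      (Int.emod_nonneg i hL'.ne')).symm⟩
    have hlt := Int.emod_lt_of_pos i hL'
    rw [hn] at hi hlt
    have h1 := hcf n (i / p.length)
    have h2 := hcf (n + 1 : ℕ) (i / p.length)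
    rw [hc n (by lia), hi] at h1
    rw [hc (n + 1) (by lia), Nat.cast_add, Nat.cast_one, add_right_comm, hi] at h2
    rw [h1, h2, (zpow_mem hf _).1]
    exact p.adj_getVert_succ (by lia)
  · simpa using hc 0 (by lia)
  · lift i to ℕ using h0
    rw [hc i (by lia)]
    refine (SimpleGraph.dist_le (p.take i)).trans ?_
    rw [SimpleGraph.Walk.take_length]
    lia

end ProjComplex

/-- **Lemma 6.1 (Clay–Mangahas).**  Let `P` be a projection complex and let `f` be a
hyperbolic isometry of `P` (an automorphism of the projection complex which is
hyperbolic for the path metric).  Then for any vertex `x₀` there is a constant `B_f`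
such that `d_v(x₀, fⁿ x₀) ≤ B_f` for all `n ∈ ℤ` and all vertices
`v ∉ {x₀, fⁿ x₀}`. -/
theorem hyperbolic_bounded_projections {Y : Type*} (pc : ProjComplex Y)
    (f : Y ≃ Y)
    (hadj : ∀ x z : Y, pc.graph.Adj x z ↔ pc.graph.Adj (f x) (f z))
    (hd : ∀ v x z : Y, pc.d (f v) (f x) (f z) = pc.d v x z)
    (hhyp : ∃ x : Y, ∃ l : ℝ, 0 < l ∧
      Tendsto (fun n : ℕ => (pc.graph.dist x ((f ^ n) x) : ℝ) / n) atTop (nhds l))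
    (x₀ : Y) :
    ∃ B : ℝ, ∀ (n : ℤ) (v : Y), v ≠ x₀ → v ≠ (f ^ n) x₀ →
      pc.d v x₀ ((f ^ n) x₀) ≤ B := by
  obtain ⟨x, l, hl0, hl⟩ := hhyp
  have hf : f ∈ pc.automorphisms := ⟨fun x z => (hadj x z).symm, hd⟩
  have hgrow := pc.mul_le_dist_zpow hf hl x₀
  have hx₀ : f x₀ ≠ x₀ := fun h => by
    obtain ⟨n, hn⟩ := exists_nat_gt (2 * pc.graph.dist x x₀ / l : ℝ)
    have h1 := hgrow 0 n
    rw [div_lt_iff₀ hl0] at hn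
    have h2 := Equiv.Perm.pow_apply_eq_self_of_apply_eq_self h n
    simp only [zpow_zero, Equiv.Perm.one_apply, zpow_natCast, h2, SimpleGraph.dist_self, sub_zero,
      Nat.abs_cast, Int.cast_natCast, Nat.cast_zero, zero_add] at h1
    linarith
  obtain ⟨L, c, hL, hc, hc0, hcf, hcd⟩ := pc.exists_periodic_path hf hx₀
  have hL' : (0 : ℤ) < L := by exact_mod_cast hL
  have horbit : ∀ q : ℤ, c (L * q) = (f ^ q) x₀ := fun q => by
    rw [← zero_add ((L : ℤ) * q), hcf, hc0]
  have hnear : ∀ i : ℤ, pc.graph.dist ((f ^ (i / L)) x₀) (c i) ≤ L := fun i => by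
    have h := hcf (i % L) (i / L)
    rw [Int.emod_add_mul_ediv] at h
    rw [h, pc.dist_apply (zpow_mem hf _)]
    exact hcd _ (Int.emod_nonneg i hL'.ne') (Int.emod_lt_of_pos i hL')
  obtain ⟨N, hN⟩ := exists_nat_gt ((4 + 2 * L + 2 * pc.graph.dist x x₀) / l : ℝ)
  have hK : ∀ i j, pc.graph.dist (c i) (c j) ≤ 4 → j - i ≤ (L * (N + 1) : ℕ) := fun i j hij => by
    have h1 := hgrow (i / L) (j / L)
    have h2 : pc.graph.dist ((f ^ (i / L)) x₀) ((f ^ (j / L)) x₀) ≤ 4 + 2 * L := by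
      have t1 := pc.connected.dist_triangle (u := (f ^ (i / L)) x₀) (v := c i)
        (w := (f ^ (j / L)) x₀)
      have t2 := pc.connected.dist_triangle (u := c i) (v := c j) (w := (f ^ (j / L)) x₀)
      rw [SimpleGraph.dist_comm (u := c j)] at t2
      have n1 := hnear i
      have n2 := hnear j
      lia
    have h2' : (pc.graph.dist ((f ^ (i / L)) x₀) ((f ^ (j / L)) x₀) : ℝ) ≤ 4 + 2 * L := by
      exact_mod_cast h2
    rw [div_lt_iff₀ hl0] at hN
    have h3 : ((|j / L - i / L| : ℤ) : ℝ) < N := by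
      by_contra! hcon
      have := mul_le_mul_of_nonneg_left hcon hl0.le
      linarith
    have h4 : j / L - i / L ≤ N := (le_abs_self _).trans (by exact_mod_cast h3.le)
    have hi := Int.emod_add_mul_ediv i L
    have hj := Int.emod_add_mul_ediv j L
    have hi0 := Int.emod_nonneg i hL'.ne'
    have hj1 := Int.emod_lt_of_pos j hL'
    have h5 := mul_le_mul_of_nonneg_left h4 hL'.le
    push_cast
    linarith
  obtain ⟨M, hM⟩ := pc.exists_d_le_of_periodic hL' hf hcf ((L * (N + 1) : ℕ) + 2)
  refine ⟨3 * |pc.Cg| + 2 * |pc.Cp| + |M| + ((L * (N + 1) : ℕ) + 2) * |pc.Ce|,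
    fun n v hv hv' => ?_⟩
  rw [← horbit] at hv' ⊢
  rw [← hc0] at hv ⊢
  rcases le_total 0 n with hn | hn
  · exact pc.d_le_of_proper_path hc hK hM (by positivity) hv.symm hv'.symm
  · rw [pc.d_symm v _ _ hv.symm hv'.symm]
    exact pc.d_le_of_proper_path hc hK hM (mul_nonpos_of_nonneg_of_nonpos hL'.le hn)
      hv'.symm hv.symm
end
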